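/- arXiv:2203.13765 — 3 statements merged into one kernel-verified Lean document; each statement's English description precedes it below -/
import Mathlib

section
/- For every n ≥ 6, the cycle C_n on n vertices has full spectrum: Spec(C_n) = {0, 1, …, n−2} ∪ {n}; that is, for every k with 0 ≤ k ≤ n and k ≠ n−1 there is a proper edge coloring of C_n with exactly k uniquely colored edges, and no proper edge coloring of C_n has exactly n−1 uniquely colored edges. -/
open SimpleGraph

/-- A proper edge coloring of `G`: edges sharing a vertex receive distinct colors. -/
def IsProperEdgeColoring {V : Type*} (G : SimpleGraph V) (c : Sym2 V → ℕ) : Prop :=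
  ∀ e₁ ∈ G.edgeSet, ∀ e₂ ∈ G.edgeSet,
    e₁ ≠ e₂ → (∃ v, v ∈ e₁ ∧ v ∈ e₂) → c e₁ ≠ c e₂

/-- The set of uniquely colored edges of `F` under the coloring `c`. -/
def uniqueEdges {V : Type*} (F : SimpleGraph V) (c : Sym2 V → ℕ) : Set (Sym2 V) :=
  {e | e ∈ F.edgeSet ∧ ∀ e' ∈ F.edgeSet, c e' = c e → e' = e}

/-- `Spec F` : the set of `k` such that `F` admits a proper edge coloring with
exactly `k` uniquely colored edges. -/
def Spec {V : Type*} (F : SimpleGraph V) : Set ℕ :=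
  {k | ∃ c : Sym2 V → ℕ, IsProperEdgeColoring F c ∧ (uniqueEdges F c).ncard = k}

/-- `f` realizes a copy of `H` inside `G`. -/
def IsCopy {W V : Type*} (H : SimpleGraph W) (G : SimpleGraph V) (f : W → V) : Prop :=
  Function.Injective f ∧ ∀ a b, H.Adj a b → G.Adj (f a) (f b)

/-- Number of uniquely colored edges of the copy of `H` given by `f`. -/
noncomputable def copyUniqueCount {W V : Type*} (H : SimpleGraph W) (c : Sym2 V → ℕ)
    (f : W → V) : ℕ :=
  {e | e ∈ H.edgeSet ∧ ∀ e' ∈ H.edgeSet, c (e'.map f) = c (e.map f) → e' = e}.ncard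

def ContainsKUniqueCopy {W V : Type*} (H : SimpleGraph W) (G : SimpleGraph V)
    (c : Sym2 V → ℕ) (k : ℕ) : Prop :=
  ∃ f : W → V, IsCopy H G f ∧ k ≤ copyUniqueCount H c f

def ContainsExactlyKUniqueCopy {W V : Type*} (H : SimpleGraph W) (G : SimpleGraph V)
    (c : Sym2 V → ℕ) (k : ℕ) : Prop :=
  ∃ f : W → V, IsCopy H G f ∧ copyUniqueCount H c f = k

def ContainsRainbowCopy {W V : Type*} (H : SimpleGraph W) (G : SimpleGraph V)
    (c : Sym2 V → ℕ) : Prop :=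
  ∃ f : W → V, IsCopy H G f ∧
    ∀ e₁ ∈ H.edgeSet, ∀ e₂ ∈ H.edgeSet, e₁ ≠ e₂ → c (e₁.map f) ≠ c (e₂.map f)

/-- The double star `DS_{a,b}`: a dominating edge `y x` with `a` pendant leaves at `y`
and `b` pendant leaves at `x`. -/
def doubleStar (a b : ℕ) : SimpleGraph (Fin 2 ⊕ Fin a ⊕ Fin b) :=
  SimpleGraph.fromEdgeSet
    ({s(Sum.inl 0, Sum.inl 1)} ∪
     {e | ∃ i : Fin a, e = s(Sum.inl 0, Sum.inr (Sum.inl i))} ∪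
     {e | ∃ j : Fin b, e = s(Sum.inl 1, Sum.inr (Sum.inr j))})

/-- The caterpillar `C_{a,b,c}`: a path `x₁x₂x₃` with `a`, `b`, `c` pendant leaves
attached at `x₁`, `x₂`, `x₃` respectively. -/
def caterpillar3 (a b c : ℕ) : SimpleGraph (Fin 3 ⊕ Fin a ⊕ Fin b ⊕ Fin c) :=
  SimpleGraph.fromEdgeSet
    ({s(Sum.inl 0, Sum.inl 1), s(Sum.inl 1, Sum.inl 2)} ∪
     {e | ∃ i : Fin a, e = s(Sum.inl 0, Sum.inr (Sum.inl i))} ∪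
     {e | ∃ i : Fin b, e = s(Sum.inl 1, Sum.inr (Sum.inr (Sum.inl i)))} ∪
     {e | ∃ i : Fin c, e = s(Sum.inl 2, Sum.inr (Sum.inr (Sum.inr i)))})

/-- The rooted tree of depth 2 whose root has `k` children, each with `m` pendant
leaves. -/
def depth2Tree (k m : ℕ) : SimpleGraph (Unit ⊕ Fin k ⊕ Fin k × Fin m) :=
  SimpleGraph.fromEdgeSet
    ({e | ∃ i : Fin k, e = s(Sum.inl (), Sum.inr (Sum.inl i))} ∪
     {e | ∃ (i : Fin k) (j : Fin m),
        e = s(Sum.inr (Sum.inl i), Sum.inr (Sum.inr (i, j)))})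

/-- The edge `{i, i + 1}` of the cycle. -/
def cycleEdge (n : ℕ) (i : Fin (n + 3)) : Sym2 (Fin (n + 3)) := s(i, i + 1)

lemma cycleEdge_injective (n : ℕ) : Function.Injective (cycleEdge n) := by
  intro i j h
  rw [cycleEdge, cycleEdge, Sym2.eq_iff] at h
  obtain h | ⟨h₁, h₂⟩ := h
  · exact h.1
  · exfalso
    have h₁' := congrArg Fin.val h₁
    have h₂' := congrArg Fin.val h₂
    simp only [Fin.val_add_one, Fin.ext_iff, Fin.val_last] at h₁' h₂'
    split_ifs at h₁' h₂' <;> omega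

lemma mem_edgeSet_cycleGraph_iff (n : ℕ) (e : Sym2 (Fin (n + 3))) :
    e ∈ (cycleGraph (n + 3)).edgeSet ↔ ∃ i, cycleEdge n i = e := by
  induction e with | _ u v
  simp only [mem_edgeSet, cycleGraph_adj, cycleEdge, Sym2.eq_iff, sub_eq_iff_eq_add]
  constructor
  · rintro (rfl | rfl)
    · exact ⟨v, Or.inr ⟨rfl, add_comm _ _⟩⟩
    · exact ⟨u, Or.inl ⟨rfl, add_comm _ _⟩⟩
  · rintro ⟨i, ⟨rfl, rfl⟩ | ⟨rfl, rfl⟩⟩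
    · exact Or.inr (add_comm _ _)
    · exact Or.inl (add_comm _ _)

lemma edgeSet_cycleGraph_eq_range (n : ℕ) :
    (cycleGraph (n + 3)).edgeSet = Set.range (cycleEdge n) :=
  Set.ext (mem_edgeSet_cycleGraph_iff n)

lemma ncard_edgeSet_cycleGraph (n : ℕ) : (cycleGraph (n + 3)).edgeSet.ncard = n + 3 := by
  rw [edgeSet_cycleGraph_eq_range, Set.ncard_range_of_injective (cycleEdge_injective n),
    Nat.card_eq_fintype_card, Fintype.card_fin]

/-- An edge that is not uniquely colored shares its color with another such edge. -/
lemma ncard_uniqueEdges_add_one_ne {V : Type*} [Finite V] (F : SimpleGraph V) (c : Sym2 V → ℕ) :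
    (uniqueEdges F c).ncard + 1 ≠ F.edgeSet.ncard := by
  intro h
  have hsub : uniqueEdges F c ⊆ F.edgeSet := fun e he => he.1
  have hdiff : (F.edgeSet \ uniqueEdges F c).ncard = 1 := by
    rw [Set.ncard_sdiff hsub]
    omega
  obtain ⟨e, he⟩ := Set.ncard_eq_one.mp hdiff
  have mem_iff (x : Sym2 V) : x ∈ F.edgeSet ∧ x ∉ uniqueEdges F c ↔ x = e := by
    rw [← Set.mem_sdiff, he, Set.mem_singleton_iff]
  obtain ⟨heF, heU⟩ := (mem_iff e).mpr rfl
  refine heU ⟨heF, fun e' he' hc => (mem_iff e').mp ⟨he', fun hU => ?_⟩⟩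
  exact heU (hU.2 e heF hc.symm ▸ hU)

/-- A cyclic sequence of colors without equal neighbours gives a proper coloring of the cycle,
whose uniquely colored edges correspond to the colors occurring once. -/
lemma card_mem_spec_cycleGraph {n : ℕ} (hn : 3 ≤ n) (g : ℕ → ℕ) (S : Finset ℕ)
    (hstep : ∀ i, i + 1 < n → g i ≠ g (i + 1)) (hwrap : g (n - 1) ≠ g 0)
    (hS : ∀ i, i ∈ S ↔ i < n ∧ ∀ j < n, g j = g i → j = i) :
    S.card ∈ Spec (cycleGraph n) := by
  obtain ⟨n, rfl⟩ := Nat.exists_eq_add_of_le' hn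
  have hinj := cycleEdge_injective n
  set c : Sym2 (Fin (n + 3)) → ℕ := fun e => g (Function.invFun (cycleEdge n) e : Fin (n + 3)) with hc
  have hcE (i : Fin (n + 3)) : c (cycleEdge n i) = g i := by
    simp only [hc, Function.leftInverse_invFun hinj i]
  have hsucc (i : Fin (n + 3)) : g i ≠ g (i + 1 : Fin (n + 3)) := by
    rw [Fin.val_add_one]
    split_ifs with h
    · subst h
      exact hwrap
    · refine hstep i ?_
      have := i.isLt
      rw [Fin.ext_iff, Fin.val_last] at h
      omega
  refine ⟨c, ?_, ?_⟩
  · intro e₁ h₁ e₂ h₂ hne ⟨v, hv₁, hv₂⟩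
    obtain ⟨i, rfl⟩ := (mem_edgeSet_cycleGraph_iff n e₁).mp h₁
    obtain ⟨j, rfl⟩ := (mem_edgeSet_cycleGraph_iff n e₂).mp h₂
    rw [hcE, hcE]
    simp only [cycleEdge, Sym2.mem_iff] at hv₁ hv₂
    obtain rfl | rfl := hv₁ <;> obtain h | h := hv₂
    · exact absurd (congrArg _ h) hne
    · exact h ▸ (hsucc j).symm
    · exact h ▸ hsucc i
    · exact absurd (congrArg _ (add_right_cancel h)) hne
  · have himage : uniqueEdges (cycleGraph (n + 3)) c =
        cycleEdge n '' (Fin.val ⁻¹' (S : Set ℕ)) := by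
      ext e
      simp only [uniqueEdges, Set.mem_ofPred_eq, mem_edgeSet_cycleGraph_iff, Set.mem_image,
        Set.mem_preimage, Finset.mem_coe, hS]
      constructor
      · rintro ⟨⟨i, rfl⟩, h⟩
        refine ⟨i, ⟨i.isLt, fun j hj hg => ?_⟩, rfl⟩
        have := hinj (h (cycleEdge n ⟨j, hj⟩) ⟨_, rfl⟩ (by rw [hcE, hcE, hg]))
        exact congrArg Fin.val this
      · rintro ⟨i, ⟨-, h⟩, rfl⟩
        refine ⟨⟨i, rfl⟩, ?_⟩
        rintro _ ⟨j, rfl⟩ hg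
        rw [hcE, hcE] at hg
        exact congrArg _ (Fin.ext (h j j.isLt hg))
    rw [himage, Set.ncard_image_of_injective _ hinj,
      Set.ncard_preimage_of_injective_subset_range Fin.val_injective, Set.ncard_coe_finset]
    intro i hi
    exact ⟨⟨i, ((hS i).mp hi).1⟩, rfl⟩

lemma self_mem_spec_cycleGraph {n : ℕ} (hn : 3 ≤ n) : n ∈ Spec (cycleGraph n) := by
  have := card_mem_spec_cycleGraph hn id (Finset.range n) (by simp) (by simp; omega) (by simp)
  rwa [Finset.card_range] at this

/-- One color on two or three pairwise disjoint edges, all other edges uniquely colored. -/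
lemma sub_mem_spec_cycleGraph_of_le_three {n m : ℕ} (hn : 6 ≤ n) (hm : 2 ≤ m) (hm' : m ≤ 3) :
    n - m ∈ Spec (cycleGraph n) := by
  have h := card_mem_spec_cycleGraph (n := n) (by omega)
    (fun i => if i < 2 * m ∧ i % 2 = 0 then 0 else i + 1)
    (Finset.range n \ (Finset.range m).image (2 * ·)) (by grind) (by grind) ?_
  · rwa [Finset.card_sdiff_of_subset, Finset.card_range,
      Finset.card_image_of_injective _ (mul_right_injective₀ two_ne_zero),
      Finset.card_range] at h
    intro i
    simp only [Finset.mem_image, Finset.mem_range]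
    omega
  · intro i
    simp only [Finset.mem_sdiff, Finset.mem_image, Finset.mem_range]
    constructor
    · rintro ⟨hi, hne⟩
      have : ¬(i < 2 * m ∧ i % 2 = 0) := fun h => hne ⟨i / 2, by omega, by omega⟩
      refine ⟨hi, by grind⟩
    · rintro ⟨hi, h⟩
      refine ⟨hi, ?_⟩
      rintro ⟨a, ha, rfl⟩
      have h₀ := h 0 (by omega)
      have h₂ := h 2 (by omega)
      grind

/-- Two alternating colors on a path of `m` edges, all other edges uniquely colored. -/
lemma sub_mem_spec_cycleGraph_of_four_le {n m : ℕ} (hm : 4 ≤ m) (hmn : m ≤ n)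
    (h : m < n ∨ Even n) : n - m ∈ Spec (cycleGraph n) := by
  have h := card_mem_spec_cycleGraph (n := n) (by omega) (fun i => if i < m then i % 2 else i + 2)
    (Finset.Ico m n) (by grind) (by grind) ?_
  · rwa [Nat.card_Ico] at h
  · intro i
    rw [Finset.mem_Ico]
    constructor
    · rintro ⟨hi, hi'⟩
      exact ⟨hi', by grind⟩
    · rintro ⟨hi, h⟩
      refine ⟨?_, hi⟩
      have h₀ := h (i % 2) (by omega)
      have h₂ := h (i % 2 + 2) (by omega)
      grind

/-- Three colors, the third one on the edges with indices `0` and `3` only. -/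
lemma zero_mem_spec_cycleGraph_of_odd {n : ℕ} (hn : 7 ≤ n) (hodd : Odd n) :
    0 ∈ Spec (cycleGraph n) := by
  refine card_mem_spec_cycleGraph (by omega) (fun i => if i = 0 ∨ i = 3 then 2 else i % 2) ∅
    (by grind) (by grind) ?_
  intro i
  simp only [Finset.notMem_empty, false_iff, not_and]
  intro hi h
  have h₀ := h 0 (by omega)
  have h₁ := h 1 (by omega)
  have h₂ := h 2 (by omega)
  have h₃ := h 3 (by omega)
  have h₄ := h 4 (by omega)
  have h₅ := h 5 (by omega)
  grind

/-- For `n ≥ 6` the cycle `Cₙ` (which has `n` edges) has full spectrum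
`{0, 1, …, n−2} ∪ {n}`. -/
theorem cycle_full_spectrum (n : ℕ) (hn : 6 ≤ n) :
    Spec (SimpleGraph.cycleGraph n) = {k : ℕ | k ≤ n ∧ k ≠ n - 1} := by
  ext k
  constructor
  · rintro ⟨c, -, rfl⟩
    have hE : (cycleGraph n).edgeSet.ncard = n := by
      obtain ⟨m, rfl⟩ := Nat.exists_eq_add_of_le' (show 3 ≤ n by omega)
      exact ncard_edgeSet_cycleGraph m
    have hne := ncard_uniqueEdges_add_one_ne (cycleGraph n) c
    have hle : (uniqueEdges (cycleGraph n) c).ncard ≤ (cycleGraph n).edgeSet.ncard :=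
      Set.ncard_le_ncard fun e he => he.1
    rw [Set.mem_ofPred_eq]
    omega
  · rintro ⟨hk, hk'⟩
    obtain rfl | hlt := hk.eq_or_lt
    · exact self_mem_spec_cycleGraph (by omega)
    rw [← Nat.sub_sub_self hk]
    by_cases hm : n - k ≤ 3
    · exact sub_mem_spec_cycleGraph_of_le_three hn (by omega) hm
    by_cases h : n - k < n ∨ Even n
    · exact sub_mem_spec_cycleGraph_of_four_le (by omega) (by omega) h
    · rw [not_or, Nat.not_even_iff_odd] at h
      rw [show n - (n - k) = 0 by omega]
      exact zero_mem_spec_cycleGraph_of_odd (by grind) h.2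
end

section
/- Let r ≤ s and 0 ≤ l ≤ r be natural numbers and set j = s − r + 1. For every n, every simple graph G on n vertices with more than (r+s+l)·n/2 edges has the property that every proper edge coloring of G contains a copy of the double star DS_{r,s} with at least j + 2l uniquely colored edges. (In other words, ex_{j+2l}(n, DS_{r,s}) ≤ (r+s+l)n/2.) -/
open SimpleGraph

open Finset in
/-- If every vertex of degree greater than `D` has only neighbors of degree at most `r`, where
`2 * r ≤ D`, then the average degree is at most `D`. -/
theorem sum_degree_le_of_forall_adj {V : Type*} [Fintype V] (G : SimpleGraph V)
    [DecidableRel G.Adj] {D r : ℕ} (hD : 2 * r ≤ D)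
    (h : ∀ x y, G.Adj x y → D < G.degree x → G.degree y ≤ r) :
    ∑ v, G.degree v ≤ D * Fintype.card V := by
  have pos : ∀ {u v}, G.Adj u v → 0 < G.degree u := fun {u v} huv =>
    (G.degree_pos_iff_exists_adj u).2 ⟨v, huv⟩
  have key : ∀ u v, G.Adj u v →
      (2 : ℚ) ≤ D * (G.degree u : ℚ)⁻¹ + D * (G.degree v : ℚ)⁻¹ := by
    intro u v huv
    have hu : (0 : ℚ) < G.degree u := by exact_mod_cast pos huv
    have hv : (0 : ℚ) < G.degree v := by exact_mod_cast pos huv.symm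
    have large : ∀ {m k : ℕ}, (0 : ℚ) < k → m * k ≤ D → (m : ℚ) ≤ D * (k : ℚ)⁻¹ := by
      intro m k hk hm
      rw [← div_eq_mul_inv, le_div_iff₀ hk]
      exact_mod_cast hm
    have nonneg : ∀ k : ℕ, (0 : ℚ) ≤ D * (k : ℚ)⁻¹ := fun k => by positivity
    by_cases h1 : D < G.degree u
    · have h3 := h u v huv h1
      have := large (m := 2) hv (by omega)
      have := nonneg (G.degree u)
      push_cast at *
      linarith
    · by_cases h2 : D < G.degree v
      · have h3 := h v u huv.symm h2
        have := large (m := 2) hu (by omega)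
        have := nonneg (G.degree v)
        push_cast at *
        linarith
      · have := large (m := 1) hu (by omega)
        have := large (m := 1) hv (by omega)
        push_cast at *
        linarith
  have self : ∑ u, ∑ v ∈ G.neighborFinset u, (D * (G.degree u : ℚ)⁻¹) ≤ D * Fintype.card V := by
    calc _ ≤ ∑ _u : V, (D : ℚ) := by
          refine sum_le_sum fun u _ => ?_
          rw [sum_const, card_neighborFinset_eq_degree, nsmul_eq_mul, mul_left_comm]
          exact mul_le_of_le_one_right (by positivity) mul_inv_le_one
      _ = _ := by simp [mul_comm]
  have swap : ∑ u, ∑ v ∈ G.neighborFinset u, (D * (G.degree v : ℚ)⁻¹) =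
      ∑ u, ∑ v ∈ G.neighborFinset u, (D * (G.degree u : ℚ)⁻¹) :=
    sum_comm' (by simp [G.adj_comm])
  have low : ∑ u, ∑ v ∈ G.neighborFinset u, (2 : ℚ) ≤
      ∑ u, ∑ v ∈ G.neighborFinset u, (D * (G.degree u : ℚ)⁻¹ + D * (G.degree v : ℚ)⁻¹) :=
    sum_le_sum fun u _ => sum_le_sum fun v hv => key u v (by simpa using hv)
  simp_rw [sum_add_distrib] at low
  rw [swap] at low
  simp only [sum_const, card_neighborFinset_eq_degree, nsmul_eq_mul, ← sum_mul] at low self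
  have : (∑ v, (G.degree v : ℚ)) ≤ D * Fintype.card V := by linarith
  exact_mod_cast this

/-- The color of the edges `s(x, u)` at a fixed vertex `x` determines the neighbor `u`. -/
theorem IsProperEdgeColoring.eq_of_color_eq {V : Type*} {G : SimpleGraph V} {c : Sym2 V → ℕ}
    (hc : IsProperEdgeColoring G c) {x u v : V} (hu : G.Adj x u) (hv : G.Adj x v)
    (h : c s(x, u) = c s(x, v)) : u = v := by
  by_contra hne
  exact hc s(x, u) hu s(x, v) hv (fun he => hne (Sym2.congr_right.1 he))
    ⟨x, Sym2.mem_mk_left x u, Sym2.mem_mk_left x v⟩ h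

open Finset in
/-- Among `s + l` edges at `x`, one can choose `s` of them at most `r - l` of which
have a color in a given set of `r` colors. -/
theorem exists_subset_card_filter_color_le {V : Type*} {G : SimpleGraph V} {c : Sym2 V → ℕ}
    (hc : IsProperEdgeColoring G c) {x : V} {P : Finset V} (hP : ∀ v ∈ P, G.Adj x v)
    {C : Finset ℕ} {r s l : ℕ} (hl : l ≤ r) (hC : #C ≤ r) (hPs : s + l ≤ #P) :
    ∃ X ⊆ P, #X = s ∧ #{v ∈ X | c s(x, v) ∈ C} ≤ r - l := by
  classical
  have hbad : #{v ∈ P | c s(x, v) ∈ C} ≤ #C :=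
    card_le_card_of_injOn (fun v => c s(x, v)) (fun v hv => by simpa using (mem_filter.1 hv).2)
      fun u hu v hv huv => by
        simp only [coe_filter, Set.mem_ofPred_eq] at hu hv
        exact hc.eq_of_color_eq (hP u hu.1) (hP v hv.1) huv
  have hsplit := card_filter_add_card_filter_not (s := P) (fun v => c s(x, v) ∈ C)
  obtain ⟨Q, hQ, hQc⟩ := exists_subset_card_eq
    (min_le_right s #{v ∈ P | ¬ c s(x, v) ∈ C})
  obtain ⟨X, hQX, hXP, hXs⟩ := exists_subsuperset_card_eq (n := s)
    (hQ.trans (filter_subset _ _)) (by omega) (by omega)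
  refine ⟨X, hXP, hXs, ?_⟩
  have hsub : {v ∈ X | c s(x, v) ∈ C} ⊆ X \ Q := fun v hv => by
    rw [mem_filter] at hv
    exact mem_sdiff.2 ⟨hv.1, fun hvQ => (mem_filter.1 (hQ hvQ)).2 hv.2⟩
  have := card_le_card hsub
  rw [card_sdiff_of_subset hQX] at this
  omega

/-- The edges of `doubleStar a b`: `none` is the central edge. -/
def doubleStarEdge (a b : ℕ) : Option (Fin a ⊕ Fin b) → Sym2 (Fin 2 ⊕ Fin a ⊕ Fin b)
  | none => s(Sum.inl 0, Sum.inl 1)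
  | some (Sum.inl i) => s(Sum.inl 0, Sum.inr (Sum.inl i))
  | some (Sum.inr j) => s(Sum.inl 1, Sum.inr (Sum.inr j))

theorem doubleStarEdge_injective (a b : ℕ) : Function.Injective (doubleStarEdge a b) := by
  rintro (_ | _ | _) (_ | _ | _) h <;> simp_all [doubleStarEdge]

theorem edgeSet_doubleStar (a b : ℕ) :
    (doubleStar a b).edgeSet = Set.range (doubleStarEdge a b) := by
  ext e
  simp only [doubleStar, edgeSet_fromEdgeSet, Set.mem_sdiff, Set.mem_union, Set.mem_range,
    Option.exists, Sum.exists, doubleStarEdge, Set.mem_singleton_iff, Set.mem_ofPred_eq,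
    Sym2.mem_diagSet]
  constructor
  · rintro ⟨(h | ⟨i, h⟩) | ⟨j, h⟩, -⟩ <;> simp [h]
  · rintro (h | ⟨i, h⟩ | ⟨j, h⟩) <;> subst h <;> simp

open Finset in
/-- Disjoint sets of neighbors of two adjacent vertices whose edges share at most `m` colors
yield a copy of a double star with at most `2 * m` edges that are not uniquely colored. -/
theorem exists_isCopy_doubleStar {V : Type*} [DecidableEq V] {G : SimpleGraph V}
    {c : Sym2 V → ℕ} (hc : IsProperEdgeColoring G c) {r s m : ℕ} {x y : V} (hyx : G.Adj y x)
    {X Y : Finset V} (hY : ∀ v ∈ Y, G.Adj y v) (hX : ∀ v ∈ X, G.Adj x v) (hxY : x ∉ Y)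
    (hyX : y ∉ X) (hXY : Disjoint X Y) (hYr : #Y = r) (hXs : #X = s)
    (hm : #{v ∈ X | c s(x, v) ∈ Y.image fun w => c s(y, w)} ≤ m) :
    ∃ f, IsCopy (doubleStar r s) G f ∧
      r + s + 1 ≤ copyUniqueCount (doubleStar r s) c f + 2 * m := by
  classical
  let eY := Y.equivFinOfCardEq hYr
  let eX := X.equivFinOfCardEq hXs
  let p : Fin r → V := fun i => eY.symm i
  let q : Fin s → V := fun j => eX.symm j
  have hpY : ∀ i, p i ∈ Y := fun i => (eY.symm i).2
  have hqX : ∀ j, q j ∈ X := fun j => (eX.symm j).2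
  have hp : Function.Injective p := Subtype.val_injective.comp eY.symm.injective
  have hq : Function.Injective q := Subtype.val_injective.comp eX.symm.injective
  let f : Fin 2 ⊕ Fin r ⊕ Fin s → V := Sum.elim ![y, x] (Sum.elim p q)
  have adjp : ∀ i, G.Adj y (p i) := fun i => hY _ (hpY i)
  have adjq : ∀ j, G.Adj x (q j) := fun j => hX _ (hqX j)
  have hpx : ∀ i, p i ≠ x := fun i h => hxY (h ▸ hpY i)
  have hqy : ∀ j, q j ≠ y := fun j h => hyX (h ▸ hqX j)
  have hpq : ∀ i j, p i ≠ q j := fun i j h => disjoint_left.1 hXY (hqX j) (h ▸ hpY i)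
  refine ⟨f, ⟨?_, ?_⟩, ?_⟩
  · refine Function.Injective.sumElim ?_ (hp.sumElim hq hpq) ?_
    · intro a b
      fin_cases a <;> fin_cases b <;> simp [hyx.ne, hyx.ne']
    · intro a b
      fin_cases a <;> rcases b with i | j <;>
        simp [(adjp _).ne, (hpx _).symm, (hqy _).symm, (adjq _).ne]
  · intro a b hab
    have hmem : s(a, b) ∈ (doubleStar r s).edgeSet := hab
    rw [edgeSet_doubleStar] at hmem
    obtain ⟨t, ht⟩ := hmem
    have : s(f a, f b) ∈ G.edgeSet := by
      rw [← Sym2.map_mk, ← ht]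
      rcases t with _ | i | j
      · exact hyx
      · exact adjp i
      · exact adjq j
    exact this
  · let A : Finset (Fin r) := {i | ∃ j, c s(x, q j) = c s(y, p i)}
    let B : Finset (Fin s) := {j | ∃ i, c s(x, q j) = c s(y, p i)}
    have inj_a : ∀ {i i'}, c s(y, p i) = c s(y, p i') → i = i' := fun h =>
      hp (hc.eq_of_color_eq (adjp _) (adjp _) h)
    have inj_b : ∀ {j j'}, c s(x, q j) = c s(x, q j') → j = j' := fun h =>
      hq (hc.eq_of_color_eq (adjq _) (adjq _) h)
    have ne_a : ∀ i, c s(y, p i) ≠ c s(y, x) := fun i h =>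
      hpx i (hc.eq_of_color_eq (adjp i) hyx h)
    have ne_b : ∀ j, c s(x, q j) ≠ c s(y, x) := fun j h =>
      hqy j (hc.eq_of_color_eq (adjq j) hyx.symm (by rw [h, Sym2.eq_swap]))
    have hBm : #B ≤ m := by
      refine le_trans (card_le_card_of_injOn q (fun j hj => ?_) hq.injOn) hm
      obtain ⟨i, hi⟩ := (mem_filter.1 hj).2
      exact mem_filter.2 ⟨hqX j, mem_image.2 ⟨p i, hpY i, hi.symm⟩⟩
    have hAB : #A ≤ #B := by
      rw [← card_image_of_injective A (f := fun i => c s(y, p i)) fun _ _ h => inj_a h]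
      refine (card_le_card fun k hk => ?_).trans
        (card_image_le (s := B) (f := fun j => c s(x, q j)))
      obtain ⟨i, hi, rfl⟩ := mem_image.1 hk
      obtain ⟨j, hj⟩ := (mem_filter.1 hi).2
      exact mem_image.2 ⟨j, mem_filter.2 ⟨mem_univ _, i, hj⟩, hj⟩
    let T : Finset (Option (Fin r ⊕ Fin s)) := insertNone (Aᶜ.disjSum Bᶜ)
    have hT : #T = #Aᶜ + #Bᶜ + 1 := by simp [T]
    have hAc := card_compl_add_card A
    have hBc := card_compl_add_card B
    rw [Fintype.card_fin] at hAc hBc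
    have hsub : doubleStarEdge r s '' (T : Set (Option (Fin r ⊕ Fin s))) ⊆
        {e | e ∈ (doubleStar r s).edgeSet ∧
          ∀ e' ∈ (doubleStar r s).edgeSet, c (e'.map f) = c (e.map f) → e' = e} := by
      rintro _ ⟨t, ht, rfl⟩
      rw [edgeSet_doubleStar]
      refine ⟨⟨t, rfl⟩, ?_⟩
      rintro _ ⟨t', rfl⟩ h
      refine congrArg _ ?_
      rcases t with _ | i | j <;> rcases t' with _ | i' | j' <;>
        simp only [doubleStarEdge, Sym2.map_mk, f, Sum.elim_inl, Sum.elim_inr,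
          Matrix.cons_val_zero, Matrix.cons_val_one] at h
      · rfl
      · exact absurd h (ne_a i')
      · exact absurd h (ne_b j')
      · exact absurd h.symm (ne_a i)
      · rw [inj_a h]
      · have hi : i ∉ A := by simpa [T] using ht
        exact absurd (mem_filter.2 ⟨mem_univ _, j', h⟩) hi
      · exact absurd h.symm (ne_b j)
      · have hj : j ∉ B := by simpa [T] using ht
        exact absurd (mem_filter.2 ⟨mem_univ _, i', h.symm⟩) hj
      · rw [inj_b h]
    have hcard := Set.ncard_le_ncard hsub (Set.toFinite _)
    rw [Set.ncard_image_of_injective _ (doubleStarEdge_injective r s), Set.ncard_coe_finset] at hcard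
    unfold copyUniqueCount
    omega

/-- For `r ≤ s` and `l ≤ r`, every `n`-vertex graph with more than
`(r+s+l)·n/2` edges is such that every proper edge coloring contains a copy of
`DS_{r,s}` with at least `(s − r + 1) + 2l` uniquely colored edges; i.e.
`ex_{j+2l}(n, DS_{r,s}) ≤ (r+s+l)n/2`. -/
theorem doubleStar_kUnique_turan_upper (r s l : ℕ) (hrs : r ≤ s) (hl : l ≤ r)
    (n : ℕ) (G : SimpleGraph (Fin n)) (hG : (r + s + l) * n < 2 * G.edgeSet.ncard)
    (c : Sym2 (Fin n) → ℕ) (hc : IsProperEdgeColoring G c) :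
    ContainsKUniqueCopy (doubleStar r s) G c (s - r + 1 + 2 * l) := by
  classical
  obtain ⟨x, y, hxy, hx, hy⟩ : ∃ x y, G.Adj x y ∧ r + s + l < G.degree x ∧ r < G.degree y := by
    by_contra! h
    have := sum_degree_le_of_forall_adj G (D := r + s + l) (r := r) (by omega) h
    rw [G.sum_degrees_eq_twice_card_edges, Fintype.card_fin, ← Set.ncard_coe_finset,
      coe_edgeFinset] at this
    omega
  rw [← card_neighborFinset_eq_degree] at hx hy
  obtain ⟨Y, hYsub, hYr⟩ := Finset.exists_subset_card_eq (n := r)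
    (s := (G.neighborFinset y).erase x)
    (by rw [Finset.card_erase_of_mem (by simpa using hxy.symm)]; omega)
  have hP : s + l ≤ ((G.neighborFinset x).erase y \ Y).card := by
    have h1 := Finset.card_erase_of_mem (s := G.neighborFinset x) (a := y) (by simpa using hxy)
    have h2 := Finset.le_card_sdiff Y ((G.neighborFinset x).erase y)
    omega
  obtain ⟨X, hXsub, hXs, hXc⟩ := exists_subset_card_filter_color_le hc
    (P := (G.neighborFinset x).erase y \ Y) (C := Y.image fun w => c s(y, w)) (x := x)
    (fun v hv => by simp at hv; exact hv.1.2) hl (Finset.card_image_le.trans hYr.le) hP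
  obtain ⟨f, hf, hcount⟩ := exists_isCopy_doubleStar hc hxy.symm (X := X) (Y := Y)
    (fun v hv => by simpa using Finset.mem_of_mem_erase (hYsub hv))
    (fun v hv => by
      simpa using Finset.mem_of_mem_erase (Finset.mem_sdiff.1 (hXsub hv)).1)
    (fun h => Finset.notMem_erase x _ (hYsub h))
    (fun h => Finset.notMem_erase y _ (Finset.mem_sdiff.1 (hXsub h)).1)
    (Finset.disjoint_left.2 fun v hv => (Finset.mem_sdiff.1 (hXsub hv)).2) hYr hXs hXc
  exact ⟨f, hf, by omega⟩
end

section
/- Let s be a natural number. The complete graph K_{2s+4} admits a proper edge coloring using only 2s+3 colors, and every proper edge coloring of K_{2s+4} that uses at most 2s+3 colors (equivalently, a coloring in which every vertex is incident to exactly one edge of each color) contains no rainbow copy of the double star DS_{1,2s+1}. -/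
open SimpleGraph

/-- A coloring of a complete graph is proper as soon as any two distinct edges `va`, `vb` receive
distinct colors. -/
theorem isProperEdgeColoring_top_of_forall {V : Type*} {c : Sym2 V → ℕ}
    (h : ∀ v a b, v ≠ a → v ≠ b → a ≠ b → c s(v, a) ≠ c s(v, b)) :
    IsProperEdgeColoring (⊤ : SimpleGraph V) c := by
  rintro e₁ he₁ e₂ he₂ hne ⟨v, hv₁, hv₂⟩
  obtain ⟨a, rfl⟩ := hv₁
  obtain ⟨b, rfl⟩ := hv₂
  simp only [mem_edgeSet, top_adj] at he₁ he₂
  exact h v a b he₁ he₂ fun hab => hne (by rw [hab])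

theorem IsProperEdgeColoring.ne_of_top {V : Type*} {c : Sym2 V → ℕ}
    (hc : IsProperEdgeColoring (⊤ : SimpleGraph V) c) {v a b : V}
    (ha : v ≠ a) (hb : v ≠ b) (hab : a ≠ b) : c s(v, a) ≠ c s(v, b) :=
  hc _ (by simpa using ha) _ (by simpa using hb) (by rwa [ne_eq, Sym2.congr_right]) ⟨v, by simp, by simp⟩

/-- The round-robin coloring of pairs from `{0, …, n}`: two vertices below `n` get the color
`i + j` modulo `n`, and the pair of `i` and the extra vertex `n` gets `2 * i` modulo `n`. -/
def roundRobinColor (n : ℕ) : Sym2 (Fin (n + 1)) → ℕ :=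
  Sym2.lift ⟨fun i j =>
    if i.val = n then 2 * j.val % n else if j.val = n then 2 * i.val % n
      else (i.val + j.val) % n, by
    intro i j
    dsimp only
    split_ifs with hi hj <;> simp_all [add_comm]⟩

theorem roundRobinColor_mk (n : ℕ) (i j : Fin (n + 1)) :
    roundRobinColor n s(i, j) =
      if i.val = n then 2 * j.val % n else if j.val = n then 2 * i.val % n
        else (i.val + j.val) % n := rfl

theorem roundRobinColor_lt {n : ℕ} (hn : 0 < n) (e : Sym2 (Fin (n + 1))) :
    roundRobinColor n e < n := by
  induction e with
  | h i j =>
    rw [roundRobinColor_mk]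
    split_ifs <;> exact Nat.mod_lt _ hn

theorem isProperEdgeColoring_roundRobinColor {n : ℕ} (hn : Odd n) :
    IsProperEdgeColoring (⊤ : SimpleGraph (Fin (n + 1))) (roundRobinColor n) := by
  obtain ⟨k, hk⟩ := hn
  have hmod : ∀ x < 2 * n, x % n = if x < n then x else x - n := by
    intro x hx
    split_ifs with h
    · exact Nat.mod_eq_of_lt h
    · rw [Nat.mod_eq_sub_mod (by omega), Nat.mod_eq_of_lt (by omega)]
  refine isProperEdgeColoring_top_of_forall fun v a b hva hvb hab => ?_
  have hv := v.isLt
  have ha := a.isLt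
  have hb := b.isLt
  rw [ne_eq, Fin.ext_iff] at hva hvb hab
  rw [roundRobinColor_mk, roundRobinColor_mk]
  by_cases h₁ : v.val = n
  · rw [if_pos h₁, if_pos h₁, hmod _ (by omega), hmod _ (by omega)]
    split_ifs <;> omega
  rw [if_neg h₁, if_neg h₁]
  by_cases h₂ : a.val = n
  · rw [if_pos h₂, if_neg (by omega), hmod _ (by omega), hmod _ (by omega)]
    split_ifs <;> omega
  rw [if_neg h₂]
  by_cases h₃ : b.val = n
  · rw [if_pos h₃, hmod _ (by omega), hmod _ (by omega)]
    split_ifs <;> omega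
  rw [if_neg h₃, hmod _ (by omega), hmod _ (by omega)]
  split_ifs <;> omega

/-- A rainbow copy of `DS_{1,b}` in a properly edge-colored complete graph forces at least `b + 3`
colors: the center `x` sees `b + 2` of them, and the pendant edge at `y` carries another one. -/
theorem card_le_of_containsRainbowCopy_doubleStar_one {V : Type*} {b : ℕ} {c : Sym2 V → ℕ}
    (hc : IsProperEdgeColoring (⊤ : SimpleGraph V) c) {t : Finset ℕ}
    (ht : ∀ e ∈ (⊤ : SimpleGraph V).edgeSet, c e ∈ t)
    (h : ContainsRainbowCopy (doubleStar 1 b) (⊤ : SimpleGraph V) c) : b + 3 ≤ t.card := by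
  obtain ⟨f, ⟨hf, -⟩, hrain⟩ := h
  let x : Fin 2 ⊕ Fin 1 ⊕ Fin b := Sum.inl 1
  let y : Fin 2 ⊕ Fin 1 ⊕ Fin b := Sum.inl 0
  let z : Fin 2 ⊕ Fin 1 ⊕ Fin b := Sum.inr (Sum.inl 0)
  have hxy : x ≠ y := by simp [x, y]
  have hxz : x ≠ z := by simp [x, z]
  have hyz : y ≠ z := by simp [y, z]
  have hpend : ∀ w, x ≠ w → c s(f y, f z) ≠ c s(f x, f w) := by
    intro w hw
    by_cases hwz : w = z
    · rw [hwz, Sym2.eq_swap, Sym2.eq_swap (a := f x)]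
      exact hc.ne_of_top (hf.ne hyz.symm) (hf.ne hxz.symm) (hf.ne hxy.symm)
    · refine hrain s(y, z) ?_ s(x, w) ?_ ?_
      · simp [doubleStar, y, z]
      · rcases w with w | w | w
        · fin_cases w
          · simp [doubleStar, x]
          · simp [x] at hw
        · exact absurd (by rw [Subsingleton.elim w 0]) hwz
        · simp [doubleStar, x]
      · simp [hxy.symm, hxz.symm]
  let g : Fin 2 ⊕ Fin 1 ⊕ Fin b → ℕ := fun w => if x = w then c s(f y, f z) else c s(f x, f w)
  have hg : Function.Injective g := by
    intro u w huw
    by_contra hne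
    by_cases hu : x = u <;> by_cases hw : x = w
    · exact hne (hu.symm.trans hw)
    · exact hpend w hw (by simpa only [g, if_pos hu, if_neg hw] using huw)
    · exact hpend u hu (by simpa only [g, if_neg hu, if_pos hw] using huw.symm)
    · exact hc.ne_of_top (hf.ne hu) (hf.ne hw) (hf.ne hne)
        (by simpa only [g, if_neg hu, if_neg hw] using huw)
  have hgt : ∀ w ∈ Finset.univ, g w ∈ t := by
    intro w _
    by_cases hw : x = w
    · simpa only [g, if_pos hw] using ht _ (by simpa using hf.ne hyz)
    · simpa only [g, if_neg hw] using ht _ (by simpa using hf.ne hw)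
  have hcard := Finset.card_le_card_of_injOn g hgt hg.injOn
  simp only [Finset.card_univ, Fintype.card_sum, Fintype.card_fin] at hcard
  omega

/-- `K_{2s+4}` admits a proper edge coloring with only `2s+3` colors,
and every proper edge coloring of `K_{2s+4}` using at most `2s+3` colors contains no
rainbow copy of `DS_{1,2s+1}`. -/
theorem K_no_rainbow_DS1odd (s : ℕ) :
    (∃ c : Sym2 (Fin (2 * s + 4)) → ℕ,
      IsProperEdgeColoring (⊤ : SimpleGraph (Fin (2 * s + 4))) c ∧
      ∃ t : Finset ℕ, t.card ≤ 2 * s + 3 ∧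
        ∀ e ∈ (⊤ : SimpleGraph (Fin (2 * s + 4))).edgeSet, c e ∈ t) ∧
    (∀ c : Sym2 (Fin (2 * s + 4)) → ℕ,
      IsProperEdgeColoring (⊤ : SimpleGraph (Fin (2 * s + 4))) c →
      (∃ t : Finset ℕ, t.card ≤ 2 * s + 3 ∧
        ∀ e ∈ (⊤ : SimpleGraph (Fin (2 * s + 4))).edgeSet, c e ∈ t) →
      ¬ ContainsRainbowCopy (doubleStar 1 (2 * s + 1))
          (⊤ : SimpleGraph (Fin (2 * s + 4))) c) := by
  refine ⟨⟨roundRobinColor (2 * s + 3), isProperEdgeColoring_roundRobinColor ⟨s + 1, by ring⟩,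
    Finset.range (2 * s + 3), by simp, fun e _ => ?_⟩, ?_⟩
  · exact Finset.mem_range.2 (roundRobinColor_lt (by omega) e)
  · rintro c hc ⟨t, htcard, ht⟩ h
    have := card_le_of_containsRainbowCopy_doubleStar_one hc ht h
    omega
end
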